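/- Let G be a finite simple graph, x one of its vertices, and G' the graph obtained from G by attaching a whisker at x (adding a new vertex y and the edge xy). Then bight I(G) = bight I(G') if and only if x belongs to every maximum minimal vertex cover of G; moreover, in this case every maximum minimal vertex cover of G is also a maximum minimal vertex cover of G'. -/

import Mathlib

open SimpleGraph

variable {V : Type}

/-- `C` is a vertex cover of `G`: every edge of `G` has an endpoint in `C`. -/
def IsVC (G : SimpleGraph V) (C : Set V) : Prop :=
  ∀ ⦃u v : V⦄, G.Adj u v → u ∈ C ∨ v ∈ C

/-- `C` is a minimal vertex cover of `G`. -/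
def IsMinVC (G : SimpleGraph V) (C : Set V) : Prop :=
  IsVC G C ∧ ∀ D : Set V, D ⊂ C → ¬ IsVC G D

/-- `C` is a maximum minimal vertex cover of `G`: a minimal vertex cover of
maximal cardinality among minimal vertex covers. -/
def IsMaxMinVC (G : SimpleGraph V) (C : Set V) : Prop :=
  IsMinVC G C ∧ ∀ D : Set V, IsMinVC G D → D.ncard ≤ C.ncard

/-- The big height of the edge ideal of `G`: the maximum cardinality of a
minimal vertex cover of `G`. -/
noncomputable def bight (G : SimpleGraph V) : ℕ :=
  sSup {n : ℕ | ∃ C : Set V, IsMinVC G C ∧ C.ncard = n}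

theorem isMinVC_iff {V : Type} (G : SimpleGraph V) (C : Set V) :
    IsMinVC G C ↔ IsVC G C ∧ ∀ v ∈ C, ∃ w, w ∉ C ∧ G.Adj v w := by
  constructor
  · rintro ⟨h, hm⟩
    refine ⟨h, fun v hv => ?_⟩
    by_contra hc
    push Not at hc
    refine hm (C \ {v}) ?_ ?_
    · refine ⟨Set.diff_subset, fun hs => ?_⟩
      exact (hs hv).2 rfl
    · intro a b hab
      have h1 := h hab
      have h2 := hab.symm
      have h3 := hab.ne
      simp only [Set.mem_diff, Set.mem_singleton_iff]
      by_cases ha : a = v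
      · subst ha
        right
        refine ⟨?_, fun h => h3 h.symm⟩
        by_contra hb
        exact hc b hb hab
      · by_cases hb : b = v
        · subst hb
          left
          refine ⟨?_, ha⟩
          by_contra hb
          exact hc a hb h2
        · tauto
  · rintro ⟨h, hm⟩
    refine ⟨h, fun D hD hv => ?_⟩
    obtain ⟨v, hvC, hvD⟩ := Set.exists_of_ssubset hD
    obtain ⟨w, hw, ha⟩ := hm v hvC
    rcases hv ha with h1 | h1
    · exact hvD h1
    · exact hw (hD.1 h1)

theorem exists_isMinVC {V : Type} [Fintype V] (G : SimpleGraph V) :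
    ∃ C, IsMinVC G C := by
  obtain ⟨C, hC⟩ := (Set.toFinite {C : Set V | IsVC G C}).exists_minimal
    ⟨Set.univ, fun _ _ _ => Or.inl trivial⟩
  refine ⟨C, hC.1, fun D hD hv => hD.2 (hC.2 hv hD.1)⟩

theorem bight_bdd {V : Type} [Fintype V] (G : SimpleGraph V) :
    BddAbove {n : ℕ | ∃ C : Set V, IsMinVC G C ∧ C.ncard = n} := by
  refine ⟨(Set.univ : Set V).ncard, ?_⟩
  rintro n ⟨C, -, rfl⟩
  exact Set.ncard_le_ncard (Set.subset_univ C)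

theorem le_bight {V : Type} [Fintype V] {G : SimpleGraph V} {C : Set V}
    (h : IsMinVC G C) : C.ncard ≤ bight G :=
  le_csSup (bight_bdd G) ⟨C, h, rfl⟩

theorem exists_bight {V : Type} [Fintype V] (G : SimpleGraph V) :
    ∃ C, IsMinVC G C ∧ C.ncard = bight G := by
  obtain ⟨C, hC⟩ := exists_isMinVC G
  have hne : {n : ℕ | ∃ C : Set V, IsMinVC G C ∧ C.ncard = n}.Nonempty := ⟨_, C, hC, rfl⟩
  exact Nat.sSup_mem hne (bight_bdd G)

theorem isMaxMinVC_iff {V : Type} [Fintype V] (G : SimpleGraph V) (C : Set V) :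
    IsMaxMinVC G C ↔ IsMinVC G C ∧ C.ncard = bight G := by
  constructor
  · rintro ⟨h, hm⟩
    obtain ⟨D, hD, hc⟩ := exists_bight G
    have := hm D hD
    have := le_bight h
    exact ⟨h, by omega⟩
  · rintro ⟨h, hm⟩
    exact ⟨h, fun D hD => hm ▸ le_bight hD⟩

theorem whisker_adj {V : Type} (G : SimpleGraph V) {x y : V} (hxy : x ≠ y) (a b : V) :
    (G ⊔ SimpleGraph.fromEdgeSet {s(x, y)}).Adj a b ↔
      G.Adj a b ∨ (a = x ∧ b = y) ∨ (a = y ∧ b = x) := by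
  simp only [SimpleGraph.sup_adj, SimpleGraph.fromEdgeSet_adj, Set.mem_singleton_iff,
    Sym2.eq_iff]
  grind

theorem minVC_of_mem {V : Type} (G : SimpleGraph V) {x y : V} (hxy : x ≠ y)
    (hn : ∀ a, ¬ G.Adj y a) {C : Set V} (h : IsMinVC G C) (hx : x ∈ C) :
    IsMinVC (G ⊔ SimpleGraph.fromEdgeSet {s(x, y)}) C := by
  rw [isMinVC_iff] at h ⊢
  simp only [IsVC, whisker_adj G hxy] at h ⊢
  grind

theorem minVC_insert {V : Type} (G : SimpleGraph V) {x y : V} (hxy : x ≠ y)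
    (hn : ∀ a, ¬ G.Adj y a) {C : Set V} (h : IsMinVC G C) (hx : x ∉ C) :
    y ∉ C ∧ IsMinVC (G ⊔ SimpleGraph.fromEdgeSet {s(x, y)}) (insert y C) := by
  rw [isMinVC_iff] at h ⊢
  simp only [IsVC, whisker_adj G hxy, Set.mem_insert_iff] at h ⊢
  obtain ⟨h1, h2⟩ := h
  have hs : ∀ a, ¬ G.Adj a y := fun a h => hn a h.symm
  refine ⟨?_, ?_, ?_⟩
  · grind
  · grind
  · rintro v (rfl | hv)
    · exact ⟨x, by grind, by grind⟩
    · obtain ⟨w, hw, ha⟩ := h2 v hv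
      exact ⟨w, by grind, Or.inl ha⟩

theorem minVC_whisker {V : Type} (G : SimpleGraph V) {x y : V} (hxy : x ≠ y)
    (hn : ∀ a, ¬ G.Adj y a) {C : Set V}
    (h : IsMinVC (G ⊔ SimpleGraph.fromEdgeSet {s(x, y)}) C) :
    IsMinVC G C ∨ ∃ z ∈ C, x ∉ C \ {z} ∧ IsMinVC G (C \ {z}) := by
  have hs : ∀ a, ¬ G.Adj a y := fun a h => hn a h.symm
  have hsy : ∀ a b, G.Adj a b → G.Adj b a := fun a b h => h.symm
  have hir : ∀ a, ¬ G.Adj a a := fun a => G.irrefl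
  simp only [isMinVC_iff] at h ⊢
  simp only [IsVC, whisker_adj G hxy, Set.mem_diff, Set.mem_singleton_iff] at h ⊢
  obtain ⟨h1, h2⟩ := h
  by_cases hx : x ∈ C
  · by_cases hw : ∃ w, w ∉ C ∧ G.Adj x w
    · left
      refine ⟨fun a b hab => h1 (Or.inl hab), fun v hv => ?_⟩
      by_cases hvx : v = x
      · rwa [hvx]
      · grind
    · right
      refine ⟨x, hx, by simp, fun a b hab => ?_, fun v hv => ?_⟩
      · have := h1 (Or.inl hab)
        grind
      · obtain ⟨w, hw, ha⟩ := h2 v hv.1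
        exact ⟨w, by grind, by grind⟩
  · right
    have hyC : y ∈ C := by
      rcases h1 (u := x) (v := y) (by simp) with h | h
      · exact absurd h hx
      · exact h
    refine ⟨y, hyC, by grind, fun a b hab => ?_, fun v hv => ?_⟩
    · have := h1 (Or.inl hab)
      grind
    · obtain ⟨w, hw, ha⟩ := h2 v hv.1
      exact ⟨w, by grind, by grind⟩

/-- Attaching a whisker at a vertex `x` of `G` leaves the big height unchanged
iff `x` belongs to every maximum minimal vertex cover of `G`; moreover, in
this case every maximum minimal vertex cover of `G` is also one of `G'`. -/
theorem stmt5 {V : Type} [Fintype V] (G : SimpleGraph V) (x y : V)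
    (hxy : x ≠ y) (hy : y ∉ G.support) :
    (bight G = bight (G ⊔ SimpleGraph.fromEdgeSet {s(x, y)}) ↔
      ∀ C : Set V, IsMaxMinVC G C → x ∈ C) ∧
    (bight G = bight (G ⊔ SimpleGraph.fromEdgeSet {s(x, y)}) →
      ∀ C : Set V, IsMaxMinVC G C →
        IsMaxMinVC (G ⊔ SimpleGraph.fromEdgeSet {s(x, y)}) C) := by
  have hn : ∀ a, ¬ G.Adj y a := fun a h => hy ⟨a, h⟩
  have key : bight G = bight (G ⊔ SimpleGraph.fromEdgeSet {s(x, y)}) ↔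
      ∀ C : Set V, IsMaxMinVC G C → x ∈ C := by
    constructor
    · intro he C hC
      rw [isMaxMinVC_iff] at hC
      by_contra hx
      obtain ⟨hyC, hm⟩ := minVC_insert G hxy hn hC.1 hx
      have h1 := le_bight hm
      rw [Set.ncard_insert_of_notMem hyC] at h1
      omega
    · intro hall
      apply le_antisymm
      · obtain ⟨C, hC, hc⟩ := exists_bight G
        rw [← hc]
        exact le_bight (minVC_of_mem G hxy hn hC (hall C ((isMaxMinVC_iff G C).2 ⟨hC, hc⟩)))
      · obtain ⟨C, hC, hc⟩ := exists_bight (G ⊔ SimpleGraph.fromEdgeSet {s(x, y)})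
        rw [← hc]
        rcases minVC_whisker G hxy hn hC with h | ⟨z, hz, hx, h⟩
        · exact le_bight h
        · have h1 := le_bight h
          have h2 := Set.ncard_diff_singleton_add_one hz
          have h3 : (C \ {z}).ncard ≠ bight G := fun h3 =>
            hx (hall _ ((isMaxMinVC_iff G _).2 ⟨h, h3⟩))
          omega
  refine ⟨key, fun he C hC => ?_⟩
  have hx := key.1 he C hC
  rw [isMaxMinVC_iff] at hC ⊢
  exact ⟨minVC_of_mem G hxy hn hC.1 hx, hC.2.trans he⟩
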